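/- Let p > 3 be a prime and n = 2(p-1). The centralizer of E_R in Out(F_n) is isomorphic to Z/p × ((F_{p-2} ⋊ Aut(F_{p-2})) ⋊ Z/2), where Aut(F_{p-2}) acts canonically on F_{p-2} and the generator τ of Z/2 acts on F_{p-2} ⋊ Aut(F_{p-2}) by τ(x, α)τ^{-1} = (x^{-1}, c_x α), with c_x denoting conjugation by x. -/

import Mathlib

/-!
Formalization of statements from:
H. Glover, H.-W. Henn, "On the mod-p cohomology of Out(F_{2(p-1)})".
-/

noncomputable section
namespace OutFormal
open FreeGroup

/-! ### The outer automorphism group `Out G = Aut G / Inn G` -/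

variable (G : Type) [Group G]

instance conjRangeNormal : ((MulAut.conj : G →* MulAut G).range).Normal := by
  constructor
  rintro x ⟨g, rfl⟩ f
  refine ⟨f g, ?_⟩
  ext h
  simp only [MulAut.conj_apply, MulAut.mul_apply, MulAut.inv_def, _root_.map_mul,
    _root_.map_inv, MulEquiv.apply_symm_apply]

/-- `Out G = Aut G / Inn G`, the group of outer automorphisms of `G`. -/
def Out : Type := MulAut G ⧸ (MulAut.conj : G →* MulAut G).range

instance : Group (Out G) := QuotientGroup.Quotient.group _

/-- The class of an automorphism in `Out G`. -/
def Out.mk : MulAut G →* Out G := QuotientGroup.mk' _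

/-- `Out(F_n)` for `F_n` the free group on `n` generators. -/
abbrev OutF (n : ℕ) : Type := Out (FreeGroup (Fin n))

variable {G}

/-- The subgroups `H` and `K` of `G` are conjugate. -/
def SubConj (H K : Subgroup G) : Prop :=
  ∃ g : G, Subgroup.map (MulAut.conj g : G ≃* G).toMonoidHom H = K

/-- `H` is subconjugate to `K`, i.e. conjugate to a subgroup of `K`. -/
def SubConjLE (H K : Subgroup G) : Prop :=
  ∃ g : G, Subgroup.map (MulAut.conj g : G ≃* G).toMonoidHom H ≤ K

/-- An elementary abelian `p`-subgroup: an abelian subgroup of exponent dividing `p`. -/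
def IsElementaryAbelian (p : ℕ) (H : Subgroup G) : Prop :=
  (∀ a ∈ H, ∀ b ∈ H, a * b = b * a) ∧ ∀ a ∈ H, a ^ p = 1

/-- The set of outer classes of those automorphisms of the free group `F_n` which act on
the free basis, transported along the identification `eI : I ≃ Fin n`, by the
formula `rhs`.  (There is exactly one such automorphism.) -/
def formalGen {n : ℕ} {I : Type} (eI : I ≃ Fin n) (rhs : I → FreeGroup I) :
    Set (OutF n) :=
  {x | ∃ φ : MulAut (FreeGroup (Fin n)),
    (∀ k : I, φ (FreeGroup.of (eI k)) = FreeGroup.freeGroupCongr eI (rhs k)) ∧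
      x = Out.mk _ φ}

/-! ### The elementary abelian subgroups `E_R`, `E_{s,p-1-s}`, `E_2`, `Δ(E_2)` -/

/-- The effect, on the free basis `u_1, …, u_{p-1}` of the fundamental group of the graph
`Θ_{p-1}` (with `u_i = b_i b_0⁻¹` for the `p` edges `b_0, …, b_{p-1}`), of the graph
automorphism cyclically rotating the `p` edges. -/
def rotWord (p : ℕ) (hp : 0 < p - 1) (k : Fin (p - 1)) : FreeGroup (Fin (p - 1)) :=
  if h : (k : ℕ) + 1 < p - 1 then of ⟨(k : ℕ) + 1, h⟩ * (of ⟨0, hp⟩)⁻¹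
  else (of ⟨0, hp⟩)⁻¹

/-- Basis of `F_{2(p-1)}` adapted to the rose `R_{2(p-1)}`:
`p` petals `x_1, …, x_p` and `p-2` further petals `y_1, …, y_{p-2}`. -/
def eRose (p : ℕ) (h2 : 2 ≤ p) : Fin p ⊕ Fin (p - 2) ≃ Fin (2 * (p - 1)) :=
  finSumFinEquiv.trans (finCongr (by omega))

/-- The generator of `E_R`: it cyclically permutes the petals `x_1, …, x_p`
and fixes the petals `y_1, …, y_{p-2}`. -/
def rhsRose (p : ℕ) : Fin p ⊕ Fin (p - 2) → FreeGroup (Fin p ⊕ Fin (p - 2))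
  | Sum.inl i => of (Sum.inl (finRotate p i))
  | Sum.inr j => of (Sum.inr j)

/-- The subgroup `E_R ≤ Out(F_{2(p-1)})` of order `p` coming from the rose
`R_{2(p-1)}` with the identity marking. -/
def ERose (p : ℕ) (h2 : 2 ≤ p) : Subgroup (OutF (2 * (p - 1))) :=
  Subgroup.closure (formalGen (eRose p h2) (rhsRose p))

/-- Basis of `F_{2(p-1)}` adapted to the graph `Θ_{p-1}^{s,p-1-s}`:
`s` loops `a_i` at the base vertex, the `p-1` classes `u_i = b_i b_0⁻¹` of the edges of
`Θ_{p-1}`, and `p-1-s` loops `c_i` at the other vertex (conjugated back to the base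
vertex by the edge `b_0`). -/
def eTheta (p s : ℕ) (hs : s ≤ p - 1) (h2 : 2 ≤ p) :
    Fin s ⊕ (Fin (p - 1) ⊕ Fin (p - 1 - s)) ≃ Fin (2 * (p - 1)) :=
  ((Equiv.refl (Fin s)).sumCongr finSumFinEquiv).trans
    (finSumFinEquiv.trans (finCongr (by omega)))

/-- The generator of `E_{s,p-1-s}`, induced by the graph automorphism of
`Θ_{p-1}^{s,p-1-s}` cyclically rotating the `p` edges of `Θ_{p-1}` and fixing all
attached loops. -/
def rhsTheta (p s : ℕ) (hp : 0 < p - 1) :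
    Fin s ⊕ (Fin (p - 1) ⊕ Fin (p - 1 - s)) →
      FreeGroup (Fin s ⊕ (Fin (p - 1) ⊕ Fin (p - 1 - s)))
  | Sum.inl a => of (Sum.inl a)
  | Sum.inr (Sum.inl k) => FreeGroup.map (fun i => Sum.inr (Sum.inl i)) (rotWord p hp k)
  | Sum.inr (Sum.inr c) =>
      of (Sum.inr (Sum.inl ⟨0, hp⟩)) * of (Sum.inr (Sum.inr c)) *
        (of (Sum.inr (Sum.inl ⟨0, hp⟩)))⁻¹

/-- The subgroup `E_{s,p-1-s} ≤ Out(F_{2(p-1)})` of order `p` coming from the marked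
graph `Θ_{p-1}^{s,p-1-s}`. -/
def ETheta (p s : ℕ) (hs : s ≤ p - 1) (h2 : 2 ≤ p) : Subgroup (OutF (2 * (p - 1))) :=
  Subgroup.closure (formalGen (eTheta p s hs h2) (rhsTheta p s (by omega)))

/-- Basis of `F_{2(p-1)}` adapted to the wedge `Θ_{p-1} ∨ Θ_{p-1}` (based at the wedge
point): the edge classes `u_i` for the left copy and `w_i` for the right copy. -/
def eWedge (p : ℕ) : Fin (p - 1) ⊕ Fin (p - 1) ≃ Fin (2 * (p - 1)) :=
  finSumFinEquiv.trans (finCongr (by omega))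

/-- The automorphism rotating the `p` edges of the left copy of `Θ_{p-1}` in
`Θ_{p-1} ∨ Θ_{p-1}`. -/
def rhsWedgeL (p : ℕ) (hp : 0 < p - 1) :
    Fin (p - 1) ⊕ Fin (p - 1) → FreeGroup (Fin (p - 1) ⊕ Fin (p - 1))
  | Sum.inl k => FreeGroup.map Sum.inl (rotWord p hp k)
  | Sum.inr k => of (Sum.inr k)

/-- The automorphism rotating the `p` edges of the right copy of `Θ_{p-1}` in
`Θ_{p-1} ∨ Θ_{p-1}`. -/
def rhsWedgeR (p : ℕ) (hp : 0 < p - 1) :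
    Fin (p - 1) ⊕ Fin (p - 1) → FreeGroup (Fin (p - 1) ⊕ Fin (p - 1))
  | Sum.inl k => of (Sum.inl k)
  | Sum.inr k => FreeGroup.map Sum.inr (rotWord p hp k)

/-- The diagonal automorphism, rotating the `p` edges of both copies of `Θ_{p-1}`. -/
def rhsWedgeDiag (p : ℕ) (hp : 0 < p - 1) :
    Fin (p - 1) ⊕ Fin (p - 1) → FreeGroup (Fin (p - 1) ⊕ Fin (p - 1))
  | Sum.inl k => FreeGroup.map Sum.inl (rotWord p hp k)
  | Sum.inr k => FreeGroup.map Sum.inr (rotWord p hp k)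

/-- The subgroup `E_2 ≅ Z/p × Z/p` of `Out(F_{2(p-1)})`, generated by the two commuting
edge rotations of the two copies of `Θ_{p-1}` in the marked graph `Θ_{p-1} ∨ Θ_{p-1}`. -/
def E2 (p : ℕ) (h2 : 2 ≤ p) : Subgroup (OutF (2 * (p - 1))) :=
  Subgroup.closure
    (formalGen (eWedge p) (rhsWedgeL p (by omega)) ∪
      formalGen (eWedge p) (rhsWedgeR p (by omega)))

/-- The first factor `Z/p × 1` of `E_2`, generated by the left edge rotation.  Under the
identification of the subgroup `E_{0,p-1}` with a factor of `E_2` this is the subgroup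
denoted `E_{0,p-1}`. -/
def E2Left (p : ℕ) (h2 : 2 ≤ p) : Subgroup (OutF (2 * (p - 1))) :=
  Subgroup.closure (formalGen (eWedge p) (rhsWedgeL p (by omega)))

/-- The diagonal subgroup `Δ(E_2)` of `E_2`. -/
def EDiag (p : ℕ) (h2 : 2 ≤ p) : Subgroup (OutF (2 * (p - 1))) :=
  Subgroup.closure (formalGen (eWedge p) (rhsWedgeDiag p (by omega)))

/-! ### Auxiliary finite groups -/

/-- The symmetric group `Σ_p`. -/
abbrev SymN (p : ℕ) : Type := Equiv.Perm (Fin p)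

/-- The normalizer `N_{Σ_p}(Z/p)` of a subgroup of order `p` of the symmetric group
`Σ_p` (namely of the subgroup generated by the standard `p`-cycle). -/
def NSigma (p : ℕ) : Subgroup (SymN p) :=
  Subgroup.normalizer (Subgroup.zpowers (finRotate p))

/-- The cyclic group `Z/p`, written multiplicatively. -/
abbrev Zc (p : ℕ) : Type := Multiplicative (ZMod p)

/-- `Aut(F_s)`, the automorphism group of the free group of rank `s`. -/
abbrev AutF (s : ℕ) : Type := MulAut (FreeGroup (Fin s))

/-- The homomorphism `Z/2 →* M` sending the generator to a given element whose square
is `1`. -/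
def z2Hom {M : Type*} [Monoid M] (a : M) (ha : a * a = 1) : Zc 2 →* M where
  toFun x := a ^ (Multiplicative.toAdd x).val
  map_one' := by simp
  map_mul' x y := by
    have hsq : a ^ 2 = 1 := by rw [pow_two, ha]
    have key : ∀ m : ℕ, a ^ (m % 2) = a ^ m := by
      intro m
      conv_rhs => rw [← Nat.div_add_mod m 2]
      rw [pow_add, pow_mul, hsq, one_pow, one_mul]
    show a ^ (Multiplicative.toAdd (x * y)).val = _
    have : Multiplicative.toAdd (x * y) = Multiplicative.toAdd x + Multiplicative.toAdd y := rfl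
    rw [this, ZMod.val_add, key, pow_add]

/-- The swap automorphism of `A × A`. -/
def swapAut (A : Type) [Group A] : MulAut (A × A) :=
  (MulEquiv.prodComm : A × A ≃* A × A)

theorem swapAut_sq (A : Type) [Group A] : swapAut A * swapAut A = 1 := by
  ext x
  · rfl
  · rfl

/-- The wreath product `A ≀ Z/2 = (A × A) ⋊ Z/2`, with `Z/2` interchanging the two
factors. -/
def wr2 (A : Type) [Group A] : Type :=
  (A × A) ⋊[z2Hom (swapAut A) (swapAut_sq A)] Zc 2

instance (A : Type) [Group A] : Group (wr2 A) := by
  unfold wr2; infer_instance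

/-! ### The group `(N ⋊ Aut N) ⋊ Z/2` with `τ(x, α)τ⁻¹ = (x⁻¹, c_x α)` -/

variable (N : Type) [Group N]

/-- The holomorph `N ⋊ Aut N`. -/
abbrev Holo : Type := N ⋊[MonoidHom.id (MulAut N)] MulAut N

/-- The involution `τ(x, α) = (x⁻¹, c_x α)` of `N ⋊ Aut N`, where `c_x` denotes
conjugation by `x`. -/
def tauFun : Holo N → Holo N := fun g => ⟨g.left⁻¹, MulAut.conj g.left * g.right⟩

theorem tauFun_mul (a b : Holo N) : tauFun N (a * b) = tauFun N a * tauFun N b := by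
  have conj_cong : ∀ (α : MulAut N) (y : N), MulAut.conj (α y) = α * MulAut.conj y * α⁻¹ := by
    intro α y; ext z
    simp [MulAut.conj_apply, MulAut.mul_apply, MulAut.inv_def, _root_.map_mul, _root_.map_inv]
  refine SemidirectProduct.ext ?_ ?_
  · show (a.left * a.right b.left)⁻¹ =
      a.left⁻¹ * (MulAut.conj a.left * a.right) b.left⁻¹
    simp [MulAut.conj_apply, MulAut.mul_apply, _root_.map_inv, mul_assoc]
  · show (MulAut.conj (a.left * a.right b.left)) * (a.right * b.right) =
      (MulAut.conj a.left * a.right) * (MulAut.conj b.left * b.right)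
    rw [_root_.map_mul, conj_cong a.right b.left]
    group

theorem tauFun_invol (a : Holo N) : tauFun N (tauFun N a) = a := by
  refine SemidirectProduct.ext ?_ ?_
  · show a.left⁻¹⁻¹ = a.left
    simp
  · show MulAut.conj a.left⁻¹ * (MulAut.conj a.left * a.right) = a.right
    rw [_root_.map_inv]
    group

/-- `τ` as an automorphism of `N ⋊ Aut N`. -/
def tauAut : MulAut (Holo N) where
  toFun := tauFun N
  invFun := tauFun N
  left_inv := tauFun_invol N
  right_inv := tauFun_invol N
  map_mul' := tauFun_mul N

theorem tauAut_sq : tauAut N * tauAut N = 1 := by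
  refine MulEquiv.ext fun a => ?_
  show tauFun N (tauFun N a) = a
  exact tauFun_invol N a

/-- The group `(N ⋊ Aut N) ⋊ Z/2`, where the generator `τ` of `Z/2` acts by
`τ(x, α)τ⁻¹ = (x⁻¹, c_x α)`. -/
def HoloZ2 : Type := Holo N ⋊[z2Hom (tauAut N) (tauAut_sq N)] Zc 2

instance : Group (HoloZ2 N) := by unfold HoloZ2; infer_instance

/-- The group `(F_m ⋊ Aut(F_m)) ⋊ Z/2`. -/
abbrev FAutZ2 (m : ℕ) : Type := HoloZ2 (FreeGroup (Fin m))

/-! ### Free group word combinatorics -/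

section Words
variable {α : Type} [DecidableEq α]

theorem toWord_mk_red {L : List (α × Bool)} (h : IsReduced L) : (mk L).toWord = L := by
  rw [toWord_mk, h.reduce_eq]

theorem isReduced_map {β : Type} {f : α → β} (hf : Function.Injective f) {L : List (α × Bool)}
    (h : IsReduced L) : IsReduced (L.map fun x => (f x.1, x.2)) := by
  unfold FreeGroup.IsReduced at *
  rw [List.isChain_map]
  exact h.imp fun a b hab he => hab (hf he)

theorem toWord_map {β : Type} [DecidableEq β] {f : α → β} (hf : Function.Injective f)
    (g : FreeGroup α) : (FreeGroup.map f g).toWord = g.toWord.map fun x => (f x.1, x.2) := by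
  conv_lhs => rw [← mk_toWord (x := g)]
  rw [FreeGroup.map.mk]
  exact toWord_mk_red (isReduced_map hf isReduced_toWord)

theorem norm_map {β : Type} [DecidableEq β] {f : α → β} (hf : Function.Injective f)
    (g : FreeGroup α) : (FreeGroup.map f g).norm = g.norm := by
  simp [FreeGroup.norm, toWord_map hf]

/-- longest common initial segment length -/
def lcp {γ : Type} [DecidableEq γ] : List γ → List γ → ℕ
  | a :: as, b :: bs => if a = b then lcp as bs + 1 else 0
  | _, _ => 0

theorem lcp_ultra {γ : Type} [DecidableEq γ] (l1 l2 l3 : List γ) :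
    min (lcp l1 l2) (lcp l2 l3) ≤ lcp l1 l3 := by
  induction l1 generalizing l2 l3 with
  | nil => simp [lcp]
  | cons a l1 ih =>
    cases l2 with
    | nil => simp [lcp]
    | cons b l2 =>
      cases l3 with
      | nil => simp [lcp]
      | cons c l3 =>
        have := ih l2 l3
        simp only [lcp]
        split_ifs <;> simp_all

theorem lcp_comm {γ : Type} [DecidableEq γ] (l1 l2 : List γ) : lcp l1 l2 = lcp l2 l1 := by
  induction l1 generalizing l2 with
  | nil => cases l2 <;> simp [lcp]
  | cons a l1 ih =>
    cases l2 with
    | nil => simp [lcp]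
    | cons b l2 => simp only [lcp, ih l2, eq_comm]

theorem lcp_self {γ : Type} [DecidableEq γ] (l1 : List γ) : lcp l1 l1 = l1.length := by
  induction l1 with
  | nil => simp [lcp]
  | cons a l1 ih => simp [lcp, ih]

theorem lcp_getElem {γ : Type} [DecidableEq γ] (l1 l2 : List γ) (j : ℕ) (h : j < lcp l1 l2) :
    l1[j]? = l2[j]? := by
  induction l1 generalizing l2 j with
  | nil => simp [lcp] at h
  | cons a l1 ih =>
    cases l2 with
    | nil => simp [lcp] at h
    | cons b l2 =>
      simp only [lcp] at h
      split_ifs at h with hab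
      · cases j with
        | zero => simp [hab]
        | succ j => simpa using ih l2 j (by omega)
      · omega

theorem norm_lcp_aux (L1 L2 : List (α × Bool)) (h1 : IsReduced L1) (h2 : IsReduced L2) :
    ((mk L1)⁻¹ * mk L2).norm + 2 * lcp L1 L2 = L1.length + L2.length := by
  induction L1 generalizing L2 with
  | nil =>
    change (1⁻¹ * mk L2).norm + _ = _
    simp [lcp, FreeGroup.norm, toWord_mk_red h2]
  | cons a L1 ih =>
    cases L2 with
    | nil =>
      change (_ * (1 : FreeGroup α)).norm + _ = _
      simp only [mul_one, norm_inv_eq, lcp]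
      simp only [FreeGroup.norm, toWord_mk_red h1]
      simp
    | cons b L2 =>
      by_cases hab : a = b
      · subst hab
        have e : (mk (a :: L1))⁻¹ * mk (a :: L2) = (mk L1)⁻¹ * mk L2 := by
          have e1 : ∀ L, mk (a :: L) = mk [a] * mk L := fun L => by rw [FreeGroup.mul_mk]; rfl
          rw [e1, e1 L2]; group
        rw [e]
        have := ih L2 h1.tail h2.tail
        simp only [lcp, if_true, List.length_cons]
        omega
      · have hr : IsReduced (invRev (a :: L1) ++ b :: L2) := by
          have hinv : IsReduced (invRev (a :: L1)) := by
            have := isReduced_toWord (x := (mk (a :: L1))⁻¹)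
            rwa [toWord_inv, toWord_mk_red h1] at this
          unfold FreeGroup.IsReduced at *
          rw [List.isChain_append]
          refine ⟨hinv, h2, ?_⟩
          intro x hx y hy
          simp [invRev] at hx hy
          subst hx hy
          intro h
          simp only at h ⊢
          by_contra hne
          apply hab
          ext
          · exact h
          · revert hne; cases a.2 <;> cases b.2 <;> simp
        have : ((mk (a :: L1))⁻¹ * mk (b :: L2)).norm = (invRev (a :: L1) ++ b :: L2).length := by
          rw [inv_mk, FreeGroup.mul_mk, FreeGroup.norm, toWord_mk_red hr]
        rw [this]
        simp [lcp, hab]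

theorem norm_lcp (g h : FreeGroup α) :
    (g⁻¹ * h).norm + 2 * lcp g.toWord h.toWord = g.norm + h.norm := by
  have := norm_lcp_aux g.toWord h.toWord isReduced_toWord isReduced_toWord
  simpa [mk_toWord, FreeGroup.norm] using this

theorem comm_head {g : FreeGroup α} {i : α} {e : Bool} {w : List (α × Bool)}
    (hg : g.toWord = (i, e) :: w) {a : α} (hai : a ≠ i) (hc : g * of a = of a * g) : False := by
  have h1 : (of a * g).toWord = (a, true) :: g.toWord := by
    have : of a * g = mk ((a, true) :: g.toWord) := by
      conv_lhs => rw [← mk_toWord (x := g)]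
      change mk [(a, true)] * _ = _
      rw [FreeGroup.mul_mk]; rfl
    rw [this, toWord_mk_red]
    have hr := isReduced_toWord (x := g)
    rw [hg] at hr ⊢
    unfold FreeGroup.IsReduced at *
    rw [List.isChain_cons_cons]
    exact ⟨fun h => absurd h hai, hr⟩
  have h2 := toWord_mul_sublist g (of a)
  rw [toWord_of, hc, h1] at h2
  have h3 := h2.eq_of_length (by simp)
  rw [hg] at h3
  simp at h3
  exact hai h3.1.1

theorem exists_head {g : FreeGroup α} (hg : g ≠ 1) : ∃ i e w, g.toWord = (i, e) :: w := by
  cases h : g.toWord with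
  | nil => exact absurd (toWord_eq_nil_iff.1 h) hg
  | cons a w => exact ⟨a.1, a.2, w, rfl⟩

theorem conj_inj [Nontrivial α] : Function.Injective (MulAut.conj : FreeGroup α →* MulAut _) := by
  rw [injective_iff_map_eq_one]
  intro g hg
  by_contra hne
  obtain ⟨i, e, w, hw⟩ := exists_head hne
  obtain ⟨a, ha⟩ := exists_ne i
  refine comm_head hw ha ?_
  have := DFunLike.congr_fun hg (of a)
  simp only [MulAut.conj_apply, MulAut.one_apply] at this
  rw [mul_inv_eq_iff_eq_mul] at this
  exact this

/-- twisted norm `g * s g * ... * s^(k-1) g` -/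
def tnorm {Γ : Type} [Group Γ] (s : MulAut Γ) (g : Γ) : ℕ → Γ
  | 0 => 1
  | k + 1 => g * s (tnorm s g k)

theorem tnorm_conj {Γ : Type} [Group Γ] (s : MulAut Γ) (g h : Γ) (k : ℕ) :
    tnorm s (h⁻¹ * g * s h) k = h⁻¹ * tnorm s g k * (s ^ k) h := by
  induction k with
  | zero => simp [tnorm]
  | succ k ih =>
    simp only [tnorm, ih, _root_.map_mul, _root_.map_inv, pow_succ', MulAut.mul_apply]
    group

theorem conj_mul_pow {Γ : Type} [Group Γ] (s : MulAut Γ) (g : Γ) (k : ℕ) :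
    (MulAut.conj g * s) ^ k = MulAut.conj (tnorm s g k) * s ^ k := by
  induction k with
  | zero => simp [tnorm]
  | succ k ih =>
    rw [pow_succ', ih]
    ext x
    simp [tnorm, pow_succ', mul_assoc]

theorem twisted_h1 (π : Equiv.Perm α) (k : ℕ) (hk : k ≠ 0) (hπ : π ^ k = 1)
    (n : ℕ) : ∀ g : FreeGroup α, g.norm ≤ n → tnorm (freeGroupCongr π) g k = 1 →
    ∃ h, g = h * freeGroupCongr π h⁻¹ := by
  have hs : (freeGroupCongr π : MulAut (FreeGroup α)) ^ k = 1 := by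
    have : ∀ j : ℕ, (freeGroupCongr π : MulAut (FreeGroup α)) ^ j = freeGroupCongr (π ^ j) := by
      intro j
      induction j with
      | zero =>
        rw [pow_zero, pow_zero]
        exact (freeGroupCongr_refl).symm
      | succ j ih =>
        rw [pow_succ', ih, pow_succ']
        exact freeGroupCongr_trans _ _
    rw [this, hπ]
    exact freeGroupCongr_refl
  induction n using Nat.strong_induction_on with
  | _ n ih =>
  intro g hgn hg
  by_cases hg1 : g = 1
  · exact ⟨1, by simp [hg1]⟩
  obtain ⟨i, e, w, hw⟩ := exists_head hg1
  have hred := isReduced_toWord (x := g)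
  by_cases hcan : ∃ u, g.toWord = (i, e) :: (u ++ [(π i, !e)])
  · obtain ⟨u, hu⟩ := hcan
    set a : FreeGroup α := mk [(i, e)] with ha
    have hsa : freeGroupCongr π a = mk [(π i, e)] := rfl
    have hg' : g = a * mk u * (freeGroupCongr π a)⁻¹ := by
      rw [← mk_toWord (x := g), hu, hsa, inv_mk, ha, FreeGroup.mul_mk, FreeGroup.mul_mk]
      simp [invRev]
    have hu' : mk u = a⁻¹ * g * (freeGroupCongr π : MulAut (FreeGroup α)) a := by
      change _ = a⁻¹ * g * freeGroupCongr π a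
      rw [hg']; group
    have hlen : g.norm = u.length + 2 := by simp [FreeGroup.norm, hu]
    obtain ⟨h, hh⟩ := ih u.length (by omega) (mk u) norm_mk_le (by
      rw [hu', tnorm_conj, hg, hs]; simp)
    refine ⟨a * h, ?_⟩
    rw [hg', hh]
    simp only [_root_.map_mul, _root_.map_inv]
    group
  · exfalso
    have key : ∀ j : ℕ, j ≠ 0 → ∃ v, (tnorm (freeGroupCongr π) g j).toWord = (i, e) :: v := by
      intro j
      induction j with
      | zero => simp
      | succ j ihj =>
        intro _
        by_cases hj : j = 0
        · subst hj
          simp only [tnorm, _root_.map_one, mul_one]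
          exact ⟨w, hw⟩
        · obtain ⟨v, hv⟩ := ihj hj
          have h2 : (freeGroupCongr π (tnorm (freeGroupCongr π) g j)).toWord =
              (π i, e) :: v.map (fun x => (π x.1, x.2)) := by
            have := toWord_map π.injective (tnorm (freeGroupCongr π) g j)
            rw [hv] at this
            exact this
          have hr2 := isReduced_toWord (x := freeGroupCongr π (tnorm (freeGroupCongr π) g j))
          rw [h2] at hr2
          refine ⟨w ++ (π i, e) :: v.map (fun x => (π x.1, x.2)), ?_⟩
          change (g * freeGroupCongr π (tnorm (freeGroupCongr π) g j)).toWord = _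
          rw [toWord_mul, h2, ← List.cons_append, ← hw]
          apply IsReduced.reduce_eq
          unfold FreeGroup.IsReduced at *
          rw [List.isChain_append]
          refine ⟨hred, hr2, ?_⟩
          rintro x hx y hy
          simp at hy
          subst hy
          intro hxe
          simp only at hxe ⊢
          by_contra hne
          apply hcan
          rw [hw] at hx
          rcases List.eq_nil_or_concat w with rfl | ⟨u, z, rfl⟩
          · simp at hx
            subst hx
            exact absurd rfl hne
          · refine ⟨u, ?_⟩
            rw [hw]
            simp [List.getLast?_cons] at hx
            subst hx
            simp
            ext
            · exact hxe
            · revert hne; cases z.2 <;> cases e <;> simp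
    obtain ⟨v, hv⟩ := key k hk
    rw [hg] at hv
    simp at hv

theorem fixed_word (f : α → α) (hf : Function.Injective f) (g : FreeGroup α)
    (h : FreeGroup.map f g = g) : ∀ x ∈ g.toWord, f x.1 = x.1 := by
  have h1 := toWord_map hf g
  rw [h] at h1
  intro x hx
  obtain ⟨n, hn, rfl⟩ := List.getElem_of_mem hx
  have := congrArg (fun l => l[n]?) h1
  simp [List.getElem?_eq_getElem hn] at this
  exact (congrArg Prod.fst this).symm

end Words

/-! ### The group `Z * C`, realised as `FreeGroup C ⋊ C` -/

section GammaC
variable {C : Type} [Group C]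

/-- `C` acts on the free group on `C` by left translation of the basis. -/
def trans (C : Type) [Group C] : C →* MulAut (FreeGroup C) where
  toFun c := freeGroupCongr (Equiv.mulLeft c)
  map_one' := by
    ext x
    simp
  map_mul' a b := by
    refine MulEquiv.ext fun x => ?_
    change FreeGroup.map _ x = FreeGroup.map _ (FreeGroup.map _ x)
    rw [FreeGroup.map.comp]
    congr 1
    ext y
    simp [mul_assoc]

theorem trans_apply (c : C) (g : FreeGroup C) : trans C c g = FreeGroup.map (fun y => c * y) g := rfl

/-- The free product of `C` with an infinite cyclic group. -/
abbrev Gam (C : Type) [Group C] : Type := FreeGroup C ⋊[trans C] C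

/-- The free generator. -/
def gx : Gam C := SemidirectProduct.inl (of 1)

theorem inl_of (c : C) : (SemidirectProduct.inl (of c) : Gam C) =
    SemidirectProduct.inr c * gx * (SemidirectProduct.inr c)⁻¹ := by
  rw [gx, ← _root_.map_inv, ← SemidirectProduct.inl_aut, trans_apply]
  simp

/-- Universal property. -/
def gLift {H : Type} [Group H] (j : C →* H) (x : H) : Gam C →* H :=
  SemidirectProduct.lift (FreeGroup.lift fun c => j c * x * (j c)⁻¹) j (by
    intro c
    ext d
    simp [trans_apply, mul_assoc])

@[simp] theorem gLift_inr {H : Type} [Group H] (j : C →* H) (x : H) (c : C) :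
    gLift j x (SemidirectProduct.inr c) = j c := by simp [gLift]

@[simp] theorem gLift_gx {H : Type} [Group H] (j : C →* H) (x : H) :
    gLift j x gx = x := by simp [gLift, gx]

theorem gam_top (S : Subgroup (Gam C)) (h1 : ∀ c : C, SemidirectProduct.inr c ∈ S)
    (h2 : gx ∈ S) : S = ⊤ := by
  rw [eq_top_iff]
  intro g _
  rw [← SemidirectProduct.inl_left_mul_inr_right g]
  refine S.mul_mem ?_ (h1 _)
  have : ∀ c : C, SemidirectProduct.inl (of c) ∈ S := by
    intro c
    rw [inl_of]
    exact S.mul_mem (S.mul_mem (h1 c) h2) (S.inv_mem (h1 c))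
  induction g.left using FreeGroup.induction_on with
  | C1 => simp
  | of c => exact this c
  | inv_of c _ => rw [_root_.map_inv]; exact S.inv_mem (this c)
  | mul a b ha hb => rw [_root_.map_mul]; exact S.mul_mem ha hb

variable [DecidableEq C]

/-- length -/
def gl (g : Gam C) : ℕ := g.left.norm

/-- overlap -/
def ov (g h : Gam C) : ℕ := lcp g.left.toWord h.left.toWord

theorem norm_trans (c : C) (g : FreeGroup C) : (trans C c g).norm = g.norm :=
  norm_map (mul_right_injective c) g

theorem toWord_trans (c : C) (g : FreeGroup C) :
    (trans C c g).toWord = g.toWord.map fun x => (c * x.1, x.2) :=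
  toWord_map (mul_right_injective c) g

theorem gl_inv_mul (g h : Gam C) : gl (g⁻¹ * h) + 2 * ov g h = gl g + gl h := by
  refine Eq.trans ?_ (norm_lcp g.left h.left)
  rw [gl, ov]
  congr 1
  rw [SemidirectProduct.mul_left, SemidirectProduct.inv_left, SemidirectProduct.inv_right,
    ← _root_.map_mul, norm_trans]

theorem gl_inr_mul (c : C) (g : Gam C) : gl (SemidirectProduct.inr c * g) = gl g := by
  simp [gl, norm_trans]

theorem gl_mul_inr (c : C) (g : Gam C) : gl (g * SemidirectProduct.inr c) = gl g := by
  simp [gl]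

theorem gl_inv (g : Gam C) : gl g⁻¹ = gl g := by
  rw [gl, gl, SemidirectProduct.inv_left, norm_trans, norm_inv_eq]

theorem ov_ultra (a b c : Gam C) : min (ov a b) (ov b c) ≤ ov a c := lcp_ultra _ _ _

theorem ov_comm (a b : Gam C) : ov a b = ov b a := lcp_comm _ _

theorem ov_self (a : Gam C) : ov a a = gl a := lcp_self _

theorem ov_inr_mul (c : C) (g h : Gam C) :
    ov (SemidirectProduct.inr c * g) (SemidirectProduct.inr c * h) = ov g h := by
  have h1 := gl_inv_mul g h
  have h2 := gl_inv_mul (SemidirectProduct.inr c * g) (SemidirectProduct.inr c * h)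
  rw [gl_inr_mul, gl_inr_mul] at h2
  have : (SemidirectProduct.inr c * g)⁻¹ * (SemidirectProduct.inr c * h) = g⁻¹ * h := by group
  rw [this] at h2
  omega

/-- `w` or its inverse. -/
def sg (w : Gam C) (b : Bool) : Gam C := cond b w w⁻¹

/-- the substituted word -/
def sub (w : Gam C) : List (C × Bool) → Gam C
  | [] => 1
  | a :: l => SemidirectProduct.inr a.1 * sg w a.2 * (SemidirectProduct.inr a.1)⁻¹ * sub w l

theorem sub_eq (w : Gam C) (l : List (C × Bool)) :
    gLift SemidirectProduct.inr w (SemidirectProduct.inl (mk l)) = sub w l := by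
  induction l with
  | nil => exact _root_.map_one _
  | cons a l ih =>
    have e1 : mk (a :: l) = mk [a] * mk l := by rw [FreeGroup.mul_mk]; rfl
    rw [e1, _root_.map_mul, _root_.map_mul, ih, sub]
    congr 1
    obtain ⟨c, b⟩ := a
    cases b
    · have : mk [(c, false)] = (of c)⁻¹ := rfl
      rw [this, _root_.map_inv, _root_.map_inv, inl_of]
      simp [sg, mul_assoc]
    · have : mk [(c, true)] = of c := rfl
      rw [this, inl_of]
      simp [sg]

theorem sub_len (w : Gam C)
    (hn : ∀ (a b : Bool) (c : C), c ≠ 1 → ov (sg w a) (SemidirectProduct.inr c * sg w b) = 0)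
    (hr : 2 * ov w⁻¹ w < gl w) (a : C × Bool) (l : List (C × Bool))
    (hl : FreeGroup.IsReduced (a :: l)) :
    gl w ≤ gl (sub w (a :: l)) ∧
    gl w ≤ ov (sg w a.2) ((SemidirectProduct.inr a.1)⁻¹ * sub w (a :: l)) + ov w⁻¹ w := by
  have hsg : ∀ b, gl (sg w b) = gl w := by intro b; cases b <;> simp [sg, gl_inv]
  have hinvmul : ∀ (c : C) g, gl ((SemidirectProduct.inr c)⁻¹ * g) = gl g := by
    intro c g; rw [← _root_.map_inv, gl_inr_mul]
  induction l generalizing a with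
  | nil =>
    have e : sub w [a] = SemidirectProduct.inr a.1 * (sg w a.2 * SemidirectProduct.inr a.1⁻¹) := by
      simp [sub, mul_assoc]
    rw [e, gl_inr_mul, gl_mul_inr, hsg, inv_mul_cancel_left]
    refine ⟨le_rfl, ?_⟩
    have h1 := gl_inv_mul (sg w a.2) (sg w a.2 * SemidirectProduct.inr a.1⁻¹)
    rw [inv_mul_cancel_left, gl_mul_inr, hsg] at h1
    have : gl (SemidirectProduct.inr a.1⁻¹ : Gam C) = 0 := by simp [gl]
    omega
  | cons b l ih =>
    unfold FreeGroup.IsReduced at hl ih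
    rw [List.isChain_cons_cons] at hl
    obtain ⟨ih1, ih2⟩ := ih b hl.2
    set P' := sub w (b :: l) with hP'
    set u := (SemidirectProduct.inr a.1)⁻¹ * P' with hu
    have eP : sub w (a :: b :: l) = SemidirectProduct.inr a.1 * (sg w a.2 * u) := by
      rw [sub]; simp [hu, hP', mul_assoc]
    have gu : gl u = gl P' := hinvmul _ _
    have esg : (sg w a.2)⁻¹ = sg w (!a.2) := by cases a.2 <;> simp [sg]
    have hmid : ov (SemidirectProduct.inr (a.1⁻¹ * b.1) * sg w b.2) u =
        ov (sg w b.2) ((SemidirectProduct.inr b.1)⁻¹ * P') := by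
      rw [← ov_inr_mul (a.1⁻¹ * b.1) (sg w b.2)]
      congr 1
      rw [hu, _root_.map_mul, _root_.map_inv]; group
    have hτ0 : ov (sg w (!a.2)) (SemidirectProduct.inr (a.1⁻¹ * b.1) * sg w b.2) ≤ ov w⁻¹ w := by
      by_cases hab : a.1 = b.1
      · rw [hab, inv_mul_cancel, _root_.map_one, one_mul, ← hl.1 hab]
        cases a.2
        · simp [sg, ov_comm]
        · simp [sg]
      · rw [hn _ _ _ (by rwa [ne_eq, inv_mul_eq_one])]
        omega
    have hτ : ov (sg w (!a.2)) u ≤ ov w⁻¹ w := by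
      have := ov_ultra (sg w (!a.2)) u (SemidirectProduct.inr (a.1⁻¹ * b.1) * sg w b.2)
      rw [ov_comm u, hmid] at this
      omega
    have h1 := gl_inv_mul (sg w (!a.2)) u
    rw [← esg, inv_inv, esg, hsg] at h1
    have h2 := gl_inv_mul (sg w a.2) (sg w a.2 * u)
    rw [inv_mul_cancel_left, hsg] at h2
    rw [eP, gl_inr_mul, inv_mul_cancel_left]
    omega

theorem parity (g : Gam C) :
    gLift (1 : C →* Multiplicative (ZMod 2)) (Multiplicative.ofAdd 1) g =
      Multiplicative.ofAdd (gl g : ZMod 2) := by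
  rw [← SemidirectProduct.inl_left_mul_inr_right g, gl_mul_inr, _root_.map_mul, gLift_inr]
  simp only [MonoidHom.one_apply, mul_one, gl, SemidirectProduct.left_inl]
  generalize g.left = k
  conv_lhs => rw [← mk_toWord (x := k)]
  rw [FreeGroup.norm]
  generalize k.toWord = l
  induction l with
  | nil => exact _root_.map_one _
  | cons a l ih =>
    have e1 : mk (a :: l) = mk [a] * mk l := by rw [FreeGroup.mul_mk]; rfl
    rw [e1, _root_.map_mul, _root_.map_mul, ih]
    obtain ⟨c, b⟩ := a
    have h1 : gLift (1 : C →* Multiplicative (ZMod 2)) (Multiplicative.ofAdd 1)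
      (SemidirectProduct.inl (of c)) = Multiplicative.ofAdd 1 := by
      rw [inl_of]; simp
    have h2 : gLift (1 : C →* Multiplicative (ZMod 2)) (Multiplicative.ofAdd 1)
      (SemidirectProduct.inl (mk [(c, b)])) = Multiplicative.ofAdd 1 := by
      cases b
      · have : mk [(c, false)] = (of c)⁻¹ := rfl
        rw [this, _root_.map_inv, _root_.map_inv, h1]
        rfl
      · exact h1
    rw [h2, ← ofAdd_add]
    simp [add_comm]

theorem ov_inv_self (w : Gam C) (hodd : Odd (gl w)) : 2 * ov w⁻¹ w < gl w := by
  by_contra hcon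
  obtain ⟨j, hj⟩ := hodd
  have h := lcp_getElem (w⁻¹).left.toWord w.left.toWord j (by unfold ov at hcon; omega)
  rw [SemidirectProduct.inv_left, toWord_trans, toWord_inv] at h
  have hlen : w.left.toWord.length = 2 * j + 1 := hj
  have hj1 : j < w.left.toWord.length := by omega
  simp only [invRev, List.getElem?_map] at h
  rw [List.getElem?_reverse (by simp; omega)] at h
  simp only [List.getElem?_map, List.length_map, hlen] at h
  rw [show 2 * j + 1 - 1 - j = j by omega, List.getElem?_eq_getElem hj1] at h
  simp at h
  have := congrArg Prod.snd h
  simp at this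

theorem lemmaC (w : Gam C)
    (hw : ∀ S : Subgroup (Gam C), (∀ c : C, SemidirectProduct.inr c ∈ S) → w ∈ S → S = ⊤) :
    ∃ (c c' : C) (b : Bool), w = SemidirectProduct.inr c * sg gx b * SemidirectProduct.inr c' := by
  have hodd : Odd (gl w) := by
    by_contra heven
    rw [Nat.not_odd_iff_even] at heven
    have := hw (gLift (1 : C →* Multiplicative (ZMod 2)) (Multiplicative.ofAdd 1)).ker
      (by intro c; rw [MonoidHom.mem_ker]; simp)
      (by rw [MonoidHom.mem_ker, parity, (ZMod.natCast_eq_zero_iff_even).2 heven]; rfl)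
    have h2 : (gx : Gam C) ∈ (gLift (1 : C →* Multiplicative (ZMod 2))
      (Multiplicative.ofAdd 1)).ker := by rw [this]; trivial
    rw [MonoidHom.mem_ker, gLift_gx] at h2
    exact absurd h2 (by decide)
  have hpos : gl w ≠ 0 := by rintro h; simp [h] at hodd
  have hne : w.left ≠ 1 := by rintro h; apply hpos; simp [gl, h]
  have hne' : (w⁻¹).left ≠ 1 := by
    rintro h; apply hpos; rw [← gl_inv]; simp only [gl, h, FreeGroup.norm_one]
  obtain ⟨c1, b1, l1, h1⟩ := exists_head hne
  obtain ⟨c2, b2, l2, h2⟩ := exists_head hne'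
  set v : Gam C := SemidirectProduct.inr c1⁻¹ * w * SemidirectProduct.inr c2 with hv
  have hglv : gl v = gl w := by rw [hv, gl_mul_inr, gl_inr_mul]
  have hv1 : ∃ b l, v.left.toWord = (1, b) :: l := by
    refine ⟨b1, l1.map fun x => (c1⁻¹ * x.1, x.2), ?_⟩
    rw [hv, SemidirectProduct.mul_left, SemidirectProduct.mul_left]
    simp only [SemidirectProduct.left_inr, SemidirectProduct.right_inr, one_mul, _root_.map_one,
      mul_one]
    rw [toWord_trans, h1]
    simp
  have hv2 : ∃ b l, (v⁻¹).left.toWord = (1, b) :: l := by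
    refine ⟨b2, l2.map fun x => (c2⁻¹ * x.1, x.2), ?_⟩
    have : v⁻¹ = SemidirectProduct.inr c2⁻¹ * w⁻¹ * SemidirectProduct.inr c1 := by
      rw [hv]; simp [mul_assoc]
    rw [this]
    rw [SemidirectProduct.mul_left, SemidirectProduct.mul_left]
    simp only [SemidirectProduct.left_inr, SemidirectProduct.right_inr, one_mul, _root_.map_one,
      mul_one]
    rw [toWord_trans, h2]
    simp
  have hvs : ∀ a, ∃ b l, (sg v a).left.toWord = (1, b) :: l := by
    intro a; cases a
    · exact hv2
    · exact hv1
  have hn : ∀ (a b : Bool) (c : C), c ≠ 1 →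
      ov (sg v a) (SemidirectProduct.inr c * sg v b) = 0 := by
    intro a b c hc
    obtain ⟨e, l, h⟩ := hvs a
    obtain ⟨e', l', h'⟩ := hvs b
    unfold ov
    rw [SemidirectProduct.mul_left, SemidirectProduct.left_inr, one_mul,
      SemidirectProduct.right_inr, toWord_trans, h, h']
    simp [lcp, Ne.symm hc]
  have hr := ov_inv_self v (by rwa [hglv])
  have htop : (gLift SemidirectProduct.inr v).range = (⊤ : Subgroup (Gam C)) := by
    apply hw
    · intro c; exact ⟨SemidirectProduct.inr c, by simp⟩
    · refine ⟨SemidirectProduct.inr c1 * gx * SemidirectProduct.inr c2⁻¹, ?_⟩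
      simp [hv, mul_assoc]
  have hx : (gx : Gam C) ∈ (gLift SemidirectProduct.inr v).range := by rw [htop]; trivial
  obtain ⟨g, hg⟩ := hx
  rw [← SemidirectProduct.inl_left_mul_inr_right g, _root_.map_mul, gLift_inr,
    ← mk_toWord (x := g.left), sub_eq] at hg
  have hgl : gl (sub v g.left.toWord) = 1 := by
    rw [← gl_mul_inr g.right, hg]; simp [gl, gx]
  have hle : gl w ≤ 1 := by
    have hred := isReduced_toWord (x := g.left)
    cases hL : g.left.toWord with
    | nil => rw [hL] at hgl; simp [sub, gl] at hgl
    | cons a l =>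
      rw [hL] at hred hgl
      have := (sub_len v hn hr a l hred).1
      omega
  have hlen : w.left.toWord.length = 1 := by
    have : gl w = w.left.toWord.length := rfl
    omega
  rw [h1] at hlen
  simp at hlen
  subst hlen
  refine ⟨c1, c1⁻¹ * w.right, b1, ?_⟩
  conv_lhs => rw [← SemidirectProduct.inl_left_mul_inr_right w, ← mk_toWord (x := w.left), h1]
  rw [_root_.map_mul, ← mul_assoc]
  congr 1
  have := inl_of c1
  cases b1
  · have e : mk [(c1, false)] = (of c1)⁻¹ := rfl
    rw [e, _root_.map_inv, this]
    simp [sg, mul_assoc]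
  · rw [_root_.map_inv]; exact this

end GammaC

/-! ### The automorphisms of `F_{p+m}` -/

section Autos
variable {p m : ℕ}

/-- The free group on `x_i` (`i : ZMod p`) and `y_j` (`j : Fin m`). -/
abbrev Fr (p m : ℕ) : Type := FreeGroup (ZMod p ⊕ Fin m)

/-- The generator `x_i`. -/
def X (i : ZMod p) : Fr p m := of (Sum.inl i)

/-- The inclusion of the free factor on the `y_j`. -/
def inB : FreeGroup (Fin m) →* Fr p m := FreeGroup.map Sum.inr

/-- Retraction onto the free factor on the `y_j`. -/
def rB : Fr p m →* FreeGroup (Fin m) := FreeGroup.lift (Sum.elim (fun _ => 1) of)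

/-- Retraction onto the free factor on the `x_i`. -/
def qX : Fr p m →* FreeGroup (ZMod p) := FreeGroup.lift (Sum.elim of (fun _ => 1))

@[simp] theorem inB_of (j : Fin m) : (inB (of j) : Fr p m) = of (Sum.inr j) := by simp [inB]
@[simp] theorem rB_X (i : ZMod p) : rB (X i : Fr p m) = 1 := by simp [rB, X]
@[simp] theorem qX_X (i : ZMod p) : qX (X i : Fr p m) = of i := by simp [qX, X]
@[simp] theorem rB_inB (b : FreeGroup (Fin m)) : rB (inB b : Fr p m) = b := by
  have h : ((rB : Fr p m →* _).comp inB) = MonoidHom.id _ := by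
    ext j; simp [rB]
  exact DFunLike.congr_fun h b
@[simp] theorem qX_inB (b : FreeGroup (Fin m)) : qX (inB b : Fr p m) = 1 := by
  have h : ((qX : Fr p m →* _).comp inB) = 1 := by
    ext j; simp [qX]
  exact DFunLike.congr_fun h b

theorem inB_inj : Function.Injective (inB : FreeGroup (Fin m) →* Fr p m) :=
  Function.LeftInverse.injective rB_inB

theorem fr_hom_ext {H : Type} [Group H] {f g : Fr p m →* H} (h1 : ∀ i, f (X i) = g (X i))
    (h2 : ∀ b, f (inB b) = g (inB b)) : f = g := by
  ext x
  rcases x with i | j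
  · exact h1 i
  · rw [← inB_of]; exact h2 _

theorem fr_aut_ext {f g : MulAut (Fr p m)} (h1 : ∀ i, f (X i) = g (X i))
    (h2 : ∀ b, f (inB b) = g (inB b)) : f = g := by
  have : (f.toMonoidHom : Fr p m →* Fr p m) = g.toMonoidHom := fr_hom_ext h1 h2
  exact MulEquiv.ext fun x => DFunLike.congr_fun this x

/-- permutation of the basis -/
def permS (p m : ℕ) (k : ZMod p) : Equiv.Perm (ZMod p ⊕ Fin m) :=
  (Equiv.addLeft k).sumCongr (Equiv.refl _)

theorem frc_X (k i : ZMod p) : freeGroupCongr (permS p m k) (X i) = X (k + i) := by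
  change FreeGroup.map _ (of _) = _
  rw [FreeGroup.map.of]; rfl

theorem frc_inB (k : ZMod p) (b : FreeGroup (Fin m)) :
    freeGroupCongr (permS p m k) (inB b) = inB b := by
  change FreeGroup.map _ (FreeGroup.map _ b) = FreeGroup.map _ b
  rw [FreeGroup.map.comp]; rfl

/-- rotation of the `x_i` -/
def S : Zc p →* MulAut (Fr p m) where
  toFun k := freeGroupCongr (permS p m (Multiplicative.toAdd k))
  map_one' := by
    apply fr_aut_ext
    · intro i; rw [frc_X]; simp
    · intro b; rw [frc_inB]; simp
  map_mul' a b := by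
    apply fr_aut_ext
    · intro i; simp only [MulAut.mul_apply]; rw [frc_X, frc_X, frc_X]; simp [add_assoc]
    · intro y; simp only [MulAut.mul_apply]; rw [frc_inB, frc_inB, frc_inB]

@[simp] theorem S_X (k : Zc p) (i : ZMod p) :
    S k (X i : Fr p m) = X (Multiplicative.toAdd k + i) := frc_X _ _
@[simp] theorem S_inB (k : Zc p) (b : FreeGroup (Fin m)) :
    S k (inB b : Fr p m) = inB b := frc_inB _ _

/-- `x_i ↦ x_i g`, `y ↦ α y` -/
def AA (a : Holo (FreeGroup (Fin m))) : Fr p m →* Fr p m :=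
  FreeGroup.lift (Sum.elim (fun i => X i * inB a.left) (fun j => inB (a.right (of j))))

@[simp] theorem AA_X (a : Holo (FreeGroup (Fin m))) (i : ZMod p) :
    AA a (X i) = X i * inB a.left := by simp [AA, X]
@[simp] theorem AA_inB (a : Holo (FreeGroup (Fin m))) (b : FreeGroup (Fin m)) :
    (AA a (inB b) : Fr p m) = inB (a.right b) := by
  have h : ((AA a : Fr p m →* _).comp inB) = inB.comp a.right.toMonoidHom := by
    ext j; simp [AA]
  exact DFunLike.congr_fun h b

theorem AA_mul (a b : Holo (FreeGroup (Fin m))) :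
    (AA (a * b) : Fr p m →* Fr p m) = (AA a).comp (AA b) := by
  apply fr_hom_ext
  · intro i; simp [mul_assoc]
  · intro y; simp

theorem AA_one : (AA 1 : Fr p m →* Fr p m) = MonoidHom.id _ := by
  apply fr_hom_ext
  · intro i; simp
  · intro y; simp

/-- The same, as an automorphism. -/
def A : Holo (FreeGroup (Fin m)) →* MulAut (Fr p m) where
  toFun a := MonoidHom.toMulEquiv (AA a) (AA a⁻¹) (by rw [← AA_mul, inv_mul_cancel, AA_one])
    (by rw [← AA_mul, mul_inv_cancel, AA_one])
  map_one' := by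
    apply fr_aut_ext
    · intro i; simp
    · intro y; simp
  map_mul' a b := by
    apply fr_aut_ext
    · intro i; simp [mul_assoc]
    · intro y; simp

@[simp] theorem A_X (a : Holo (FreeGroup (Fin m))) (i : ZMod p) :
    A a (X i) = X i * inB a.left := AA_X a i
@[simp] theorem A_inB (a : Holo (FreeGroup (Fin m))) (b : FreeGroup (Fin m)) :
    (A a (inB b) : Fr p m) = inB (a.right b) := AA_inB a b

/-- `x_i ↦ x_i⁻¹`, `y ↦ y` -/
def TT : Fr p m →* Fr p m :=
  FreeGroup.lift (Sum.elim (fun i => (X i)⁻¹) (fun j => inB (of j)))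

@[simp] theorem TT_X (i : ZMod p) : TT (X i : Fr p m) = (X i)⁻¹ := by simp [TT, X]
@[simp] theorem TT_inB (b : FreeGroup (Fin m)) : (TT (inB b) : Fr p m) = inB b := by
  have h : ((TT : Fr p m →* _).comp inB) = inB := by
    ext j; simp [TT]
  exact DFunLike.congr_fun h b

theorem TT_TT : (TT : Fr p m →* Fr p m).comp TT = MonoidHom.id _ := by
  apply fr_hom_ext
  · intro i; simp
  · intro y; simp

/-- The same, as an automorphism. -/
def T : MulAut (Fr p m) := MonoidHom.toMulEquiv TT TT TT_TT TT_TT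

@[simp] theorem T_X (i : ZMod p) : T (X i : Fr p m) = (X i)⁻¹ := TT_X i
@[simp] theorem T_inB (b : FreeGroup (Fin m)) : (T (inB b) : Fr p m) = inB b := TT_inB b

theorem T_T : (T : MulAut (Fr p m)) * T = 1 := by
  apply fr_aut_ext
  · intro i; simp
  · intro y; simp

theorem S_A (k : Zc p) (a : Holo (FreeGroup (Fin m))) : Commute (S k : MulAut (Fr p m)) (A a) := by
  apply fr_aut_ext
  · intro i; simp
  · intro y; simp

theorem S_T (k : Zc p) : Commute (S k : MulAut (Fr p m)) T := by
  apply fr_aut_ext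
  · intro i; simp
  · intro y; simp

theorem z2_cases (c : Zc 2) : c = 1 ∨ c = Multiplicative.ofAdd 1 := by
  revert c; decide

theorem z2Hom_gen {M : Type*} [Monoid M] (a : M) (ha : a * a = 1) :
    z2Hom a ha (Multiplicative.ofAdd 1) = a := pow_one a

theorem S_z2 (k : Zc p) (c : Zc 2) : Commute (S k : MulAut (Fr p m)) (z2Hom T T_T c) := by
  rcases z2_cases c with rfl | rfl
  · rw [_root_.map_one]; exact Commute.one_right _
  · rw [z2Hom_gen]; exact S_T k

theorem out_eq {G : Type} [Group G] {φ ψ : MulAut G} :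
    Out.mk G φ = Out.mk G ψ ↔ ∃ h, φ = MulAut.conj h * ψ := by
  have : Out.mk G φ = Out.mk G ψ ↔ ∃ z ∈ (MulAut.conj : G →* MulAut G).range, φ * z = ψ :=
    QuotientGroup.mk'_eq_mk' _
  rw [this]
  constructor
  · rintro ⟨_, ⟨z, rfl⟩, rfl⟩
    refine ⟨φ z⁻¹, ?_⟩
    ext x
    simp [mul_assoc]
  · rintro ⟨h, rfl⟩
    refine ⟨_, ⟨ψ⁻¹ h⁻¹, rfl⟩, ?_⟩
    ext x
    simp [mul_assoc]

theorem tau_left {N : Type} [Group N] (a : Holo N) : (tauAut N a).left = a.left⁻¹ := rfl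
theorem tau_right {N : Type} [Group N] (a : Holo N) :
    (tauAut N a).right = MulAut.conj a.left * a.right := rfl

/-- The map on the second factor. -/
def Th2 : (Holo (FreeGroup (Fin m)) ⋊[z2Hom (tauAut _) (tauAut_sq _)] Zc 2) →* Out (Fr p m) :=
  SemidirectProduct.lift ((Out.mk _).comp A) ((Out.mk _).comp (z2Hom T T_T)) (by
    intro c
    rcases z2_cases c with rfl | rfl
    · ext a <;> simp
    · rw [z2Hom_gen]
      refine MonoidHom.ext fun a => ?_
      simp only [MonoidHom.comp_apply, z2Hom_gen, MulEquiv.coe_toMonoidHom, MulAut.conj_apply,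
        ← _root_.map_mul, ← _root_.map_inv]
      rw [out_eq]
      refine ⟨inB a.left, ?_⟩
      have hT : (T : MulAut (Fr p m))⁻¹ = T := inv_eq_of_mul_eq_one_left T_T
      rw [hT]
      apply fr_aut_ext
      · intro i; simp [tau_left, tau_right, mul_assoc]
      · intro y; simp [tau_left, tau_right, mul_assoc])

/-- Unfolding of `HoloZ2`. -/
def hzEquiv (N : Type) [Group N] :
    HoloZ2 N ≃* (Holo N ⋊[z2Hom (tauAut N) (tauAut_sq N)] Zc 2) where
  toFun x := x
  invFun x := x
  left_inv _ := rfl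
  right_inv _ := rfl
  map_mul' _ _ := rfl

theorem Th2_apply (x) : (Th2 x : Out (Fr p m)) =
    Out.mk _ (A x.left * z2Hom T T_T x.right) := by
  rw [_root_.map_mul]; rfl

/-- The map identifying the centralizer. -/
def Th : Zc p × HoloZ2 (FreeGroup (Fin m)) →* Out (Fr p m) :=
  MonoidHom.noncommCoprod ((Out.mk _).comp S) (Th2.comp (hzEquiv _).toMonoidHom) (by
    intro k h
    change Commute (Out.mk _ (S k)) (Th2 (hzEquiv _ h))
    rw [Th2_apply]
    exact ((S_A k _).mul_right (S_z2 k _)).map (Out.mk (Fr p m)))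

theorem Th_apply (x : Zc p × HoloZ2 (FreeGroup (Fin m))) : (Th x : Out (Fr p m)) =
    Out.mk _ (S x.1 * (A (hzEquiv _ x.2).left * z2Hom T T_T (hzEquiv _ x.2).right)) := by
  rw [_root_.map_mul, ← Th2_apply]; rfl

instance frNontriv [Fact (1 < p)] : Nontrivial (ZMod p ⊕ Fin m) :=
  ⟨Sum.inl 0, Sum.inl 1, by simp⟩

theorem fixed_inB [Fact (1 < p)] (h : Fr p m)
    (hf : S (Multiplicative.ofAdd (1 : ZMod p)) h = h) : ∃ b, h = inB b := by
  have h1 := fixed_word (permS p m 1) (permS p m 1).injective h hf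
  rw [← mk_toWord (x := h)]
  generalize h.toWord = l at h1
  induction l with
  | nil => exact ⟨1, by simp; rfl⟩
  | cons a l ih =>
    obtain ⟨b, hb⟩ := ih fun x hx => h1 x (List.mem_cons_of_mem _ hx)
    have e1 : mk (a :: l) = mk [a] * mk l := by rw [FreeGroup.mul_mk]; rfl
    have ha := h1 a List.mem_cons_self
    obtain ⟨i | j, e⟩ := a
    · simp [permS] at ha
    · refine ⟨mk [(j, e)] * b, ?_⟩
      rw [e1, hb, _root_.map_mul]; rfl

theorem conj_fixed [Nontrivial (ZMod p ⊕ Fin m)] (s : MulAut (Fr p m)) (h : Fr p m)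
    (hc : Commute s (MulAut.conj h)) : s h = h := by
  apply conj_inj
  have : MulAut.conj (s h) = s * MulAut.conj h * s⁻¹ := by ext x; simp
  rw [this, hc.eq, mul_inv_cancel_right]

theorem inB_comm_X (b : FreeGroup (Fin m)) (h : (inB b : Fr p m) * X 0 = X 0 * inB b) : b = 1 := by
  by_contra hb
  obtain ⟨i, e, w, hw⟩ := exists_head hb
  have h1 : (inB b : Fr p m).toWord = (Sum.inr i, e) :: w.map fun x => (Sum.inr x.1, x.2) := by
    rw [inB, toWord_map Sum.inr_injective, hw]; rfl
  exact comm_head h1 (a := Sum.inl 0) (by simp) h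

theorem Th_inj [Fact (1 < p)] : Function.Injective (Th : _ →* Out (Fr p m)) := by
  rw [injective_iff_map_eq_one]
  rintro ⟨k, x⟩ hx
  rw [Th_apply, ← _root_.map_one (Out.mk (Fr p m)), out_eq] at hx
  obtain ⟨h, hh⟩ := hx
  rw [mul_one] at hh
  suffices k = 1 ∧ hzEquiv _ x = 1 by
    obtain ⟨rfl, h2⟩ := this
    rw [MulEquiv.map_eq_one_iff] at h2
    rw [h2]; rfl
  simp only at hh
  set a := (hzEquiv _ x).left with ha
  set c := (hzEquiv _ x).right with hc
  have hcomm : Commute (S (Multiplicative.ofAdd (1 : ZMod p)) : MulAut (Fr p m))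
      (MulAut.conj h) := by
    rw [← hh]
    refine Commute.mul_right ?_ ((S_A _ _).mul_right (S_z2 _ _))
    rw [Commute, SemiconjBy, ← _root_.map_mul, ← _root_.map_mul, mul_comm]
  obtain ⟨b, rfl⟩ := fixed_inB h (conj_fixed _ _ hcomm)
  have hX := DFunLike.congr_fun hh (X 0)
  have hY := fun y => DFunLike.congr_fun hh (inB y)
  rcases z2_cases c with hc1 | hc1
  · rw [hc1] at hX hY
    simp at hX hY
    have hq := congrArg qX hX
    have hr := congrArg rB hX
    simp at hq hr
    have hk : Multiplicative.toAdd k = 0 := of_injective hq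
    have hk' : k = 1 := hk
    rw [hk, hr] at hX
    have hb : b = 1 := by
      apply inB_comm_X (p := p)
      rw [eq_mul_inv_iff_mul_eq] at hX
      simpa using hX.symm
    refine ⟨hk', SemidirectProduct.ext ?_ hc1⟩
    refine SemidirectProduct.ext hr ?_
    refine MulEquiv.ext fun y => ?_
    have := hY y
    rw [hb, _root_.map_one, one_mul, inv_one, mul_one] at this
    exact inB_inj this
  · exfalso
    rw [hc1, z2Hom_gen] at hX
    have hq := congrArg qX hX
    simp at hq
    have := congrArg toWord hq
    rw [toWord_inv, toWord_of, toWord_of] at this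
    simp [invRev] at this

end Autos

/-! ### The image is the whole centralizer -/

section Surj
variable {p m : ℕ}

/-- The embedding of the free group into `Gam`. -/
def io : Fr p m →* Gam (Zc p × FreeGroup (Fin m)) :=
  FreeGroup.lift (Sum.elim
    (fun i => SemidirectProduct.inr (Multiplicative.ofAdd i, 1) * gx *
      (SemidirectProduct.inr (Multiplicative.ofAdd i, 1))⁻¹)
    (fun j => SemidirectProduct.inr (1, of j)))

theorem io_X (i : ZMod p) : io (X i : Fr p m) =
    SemidirectProduct.inr (Multiplicative.ofAdd i, 1) * gx *
      (SemidirectProduct.inr (Multiplicative.ofAdd i, 1))⁻¹ := by simp [io, X]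

theorem io_X0 : io (X 0 : Fr p m) = gx := by
  rw [io_X]
  have : (SemidirectProduct.inr (Multiplicative.ofAdd 0, 1) : Gam (Zc p × FreeGroup (Fin m))) = 1 :=
    _root_.map_one _
  rw [this]; simp

theorem io_inB (b : FreeGroup (Fin m)) : io (inB b : Fr p m) = SemidirectProduct.inr (1, b) := by
  have h : ((io : Fr p m →* _).comp inB) =
      SemidirectProduct.inr.comp (MonoidHom.inr (Zc p) (FreeGroup (Fin m))) := by
    ext j <;> simp [io]
  exact DFunLike.congr_fun h b

theorem io_S (k : Zc p) (g : Fr p m) : io (S k g) =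
    SemidirectProduct.inr (k, 1) * io g * (SemidirectProduct.inr (k, 1))⁻¹ := by
  have h : ((io : Fr p m →* _).comp (S k).toMonoidHom) =
      (MulAut.conj (SemidirectProduct.inr (k, 1) :
        Gam (Zc p × FreeGroup (Fin m)))).toMonoidHom.comp io := by
    apply fr_hom_ext
    · intro i
      simp only [MonoidHom.comp_apply, MulEquiv.coe_toMonoidHom, S_X, MulAut.conj_apply, io_X,
        mul_assoc]
      have : ((Multiplicative.ofAdd (Multiplicative.toAdd k + i), 1) : Zc p × FreeGroup (Fin m))
        = (k, 1) * (Multiplicative.ofAdd i, 1) := by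
        ext <;> simp
      rw [this, _root_.map_mul, mul_inv_rev]
      simp only [mul_assoc]
    · intro b
      simp only [MonoidHom.comp_apply, MulEquiv.coe_toMonoidHom, S_inB, MulAut.conj_apply, io_inB,
        ← _root_.map_mul, ← _root_.map_inv]
      simp
  exact DFunLike.congr_fun h g

/-- `(k, b) ↦ S k * conj b` -/
def jc : Zc p × FreeGroup (Fin m) →* MulAut (Fr p m) :=
  MonoidHom.noncommCoprod S (MulAut.conj.comp inB) (by
    intro k b
    refine MulEquiv.ext fun x => ?_
    simp)

theorem jc_apply (k : Zc p) (b : FreeGroup (Fin m)) :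
    (jc (k, b) : MulAut (Fr p m)) = S k * MulAut.conj (inB b) := rfl

theorem rho_io (g : Fr p m) :
    gLift (jc : _ →* MulAut (Fr p m)) (MulAut.conj (X 0)) (io g) = MulAut.conj g := by
  have h : (gLift (jc : _ →* MulAut (Fr p m)) (MulAut.conj (X 0))).comp io = MulAut.conj := by
    apply fr_hom_ext
    · intro i
      simp only [MonoidHom.comp_apply, io_X, _root_.map_mul, _root_.map_inv, gLift_inr, gLift_gx,
        jc_apply, _root_.map_one, mul_one]
      refine MulEquiv.ext fun x => ?_
      simp
    · intro b
      simp only [MonoidHom.comp_apply, io_inB, gLift_inr, jc_apply, _root_.map_one, one_mul]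
  exact DFunLike.congr_fun h g

theorem pi_io (g : Fr p m) :
    gLift (MonoidHom.fst (Zc p) (FreeGroup (Fin m))) 1 (io g) = 1 := by
  have h : (gLift (MonoidHom.fst (Zc p) (FreeGroup (Fin m))) 1).comp io = 1 := by
    apply fr_hom_ext
    · intro i; simp [io_X]
    · intro b; simp [io_inB]
  exact DFunLike.congr_fun h g

/-- signed power -/
def sgn {G : Type} [Group G] (x : G) (b : Bool) : G := cond b x x⁻¹

theorem form_X0 [Fact (1 < p)] (ψ : MulAut (Fr p m)) (hS : ∀ k, Commute (S k) ψ)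
    (hB : ∀ b, ψ (inB b) = inB b) :
    ∃ (k : Zc p) (f f' : FreeGroup (Fin m)) (e : Bool),
      ψ (X 0) = S k (inB f * sgn (X 0) e * inB f') := by
  classical
  have hSX : ∀ i : ZMod p, ψ (X i) = S (Multiplicative.ofAdd i) (ψ (X 0)) := by
    intro i
    have := DFunLike.congr_fun (hS (Multiplicative.ofAdd i)).eq (X 0)
    simp only [MulAut.mul_apply, S_X] at this
    rw [this]; simp
  obtain ⟨c, c', e, h⟩ := lemmaC (io (ψ (X 0))) (by
    intro U h1 h2
    have h3 : ∀ g, g ∈ U.comap (io.comp ψ.toMonoidHom) := by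
      intro g
      have htop : U.comap (io.comp ψ.toMonoidHom) = ⊤ := by
        rw [eq_top_iff, ← FreeGroup.closure_range_of, Subgroup.closure_le]
        rintro _ ⟨i | j, rfl⟩
        · change io (ψ (X i)) ∈ U
          rw [hSX, io_S]
          exact U.mul_mem (U.mul_mem (h1 _) h2) (U.inv_mem (h1 _))
        · change io (ψ (of (Sum.inr j))) ∈ U
          rw [← inB_of, hB, io_inB]
          exact h1 _
      rw [htop]; trivial
    refine gam_top U h1 ?_
    have := h3 (ψ⁻¹ (X 0))
    change io (ψ (ψ⁻¹ (X 0))) ∈ U at this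
    rw [MulAut.apply_inv_self, io_X0] at this
    exact this)
  obtain ⟨k, f⟩ := c
  obtain ⟨k', f'⟩ := c'
  have h1 := pi_io (ψ (X 0))
  rw [h] at h1
  have hk : k' = k⁻¹ := by
    rw [_root_.map_mul, _root_.map_mul, gLift_inr, gLift_inr] at h1
    cases e <;> simp [sg] at h1 <;> exact (inv_eq_of_mul_eq_one_right h1).symm
  refine ⟨k, f, f', e, ?_⟩
  have h2 := rho_io (ψ (X 0))
  rw [h, hk] at h2
  apply conj_inj
  rw [← h2, _root_.map_mul, _root_.map_mul, gLift_inr, gLift_inr, jc_apply, jc_apply]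
  have hcs : ∀ g : Fr p m, MulAut.conj (S k g) = S k * MulAut.conj g * (S k)⁻¹ := by
    intro g
    refine MulEquiv.ext fun x => ?_
    simp
  have hc2 : Commute (S k⁻¹) (MulAut.conj (inB f') : MulAut (Fr p m)) := by
    refine MulEquiv.ext fun x => ?_
    simp only [MulAut.mul_apply, MulAut.conj_apply, _root_.map_mul (S k⁻¹),
      _root_.map_inv (S k⁻¹ : MulAut (Fr p m)), S_inB]
  rw [hcs, hc2.eq]
  cases e <;> simp [sg, sgn, mul_assoc]

theorem mem_S (k : Zc p) : Out.mk (Fr p m) (S k) ∈ (Th : _ →* Out (Fr p m)).range :=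
  ⟨(k, 1), by rw [Th_apply]; simp⟩

theorem mem_A (a : Holo (FreeGroup (Fin m))) :
    Out.mk (Fr p m) (A a) ∈ (Th : _ →* Out (Fr p m)).range :=
  ⟨(1, (hzEquiv _).symm (SemidirectProduct.inl a)), by rw [Th_apply]; simp⟩

theorem mem_T : Out.mk (Fr p m) T ∈ (Th : _ →* Out (Fr p m)).range :=
  ⟨(1, (hzEquiv _).symm (SemidirectProduct.inr (Multiplicative.ofAdd 1))), by
    rw [Th_apply]; simp [z2Hom_gen]⟩

theorem mem_conj (g : Fr p m) : Out.mk (Fr p m) (MulAut.conj g) = 1 := by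
  rw [← _root_.map_one (Out.mk (Fr p m)), out_eq]; exact ⟨g, by simp⟩

theorem mem_psi [Fact (1 < p)] (ψ : MulAut (Fr p m)) (hS : ∀ k, Commute (S k) ψ)
    (hB : ∀ b, ψ (inB b) = inB b) : Out.mk (Fr p m) ψ ∈ (Th : _ →* Out (Fr p m)).range := by
  obtain ⟨k, f, f', e, h⟩ := form_X0 ψ hS hB
  have hSX : ∀ i : ZMod p, ψ (X i) = S (Multiplicative.ofAdd i) (ψ (X 0)) := by
    intro i
    have := DFunLike.congr_fun (hS (Multiplicative.ofAdd i)).eq (X 0)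
    simp only [MulAut.mul_apply, S_X] at this
    rw [this]; simp
  cases e
  · obtain ⟨a, ha1, ha2⟩ : ∃ a : Holo (FreeGroup (Fin m)), a.left = (f' * f)⁻¹ ∧
      a.right = MulAut.conj f' := ⟨⟨_, _⟩, rfl, rfl⟩
    have : ψ = MulAut.conj (inB f'⁻¹) * (S k * A a * T) := by
      apply fr_aut_ext
      · intro i
        rw [hSX, h]
        simp [sgn, ha1, mul_assoc, add_comm]
      · intro b
        rw [hB]
        simp [ha2, mul_assoc]
    rw [this, _root_.map_mul, _root_.map_mul, _root_.map_mul, mem_conj, one_mul]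
    exact mul_mem (mul_mem (mem_S _) (mem_A _)) mem_T
  · obtain ⟨a, ha1, ha2⟩ : ∃ a : Holo (FreeGroup (Fin m)), a.left = f' * f ∧
      a.right = MulAut.conj f⁻¹ := ⟨⟨_, _⟩, rfl, rfl⟩
    have : ψ = MulAut.conj (inB f) * (S k * A a) := by
      apply fr_aut_ext
      · intro i
        rw [hSX, h]
        simp [sgn, ha1, mul_assoc, add_comm]
      · intro b
        rw [hB]
        simp [ha2, mul_assoc]
    rw [this, _root_.map_mul, _root_.map_mul, mem_conj, one_mul]
    exact mul_mem (mem_S _) (mem_A _)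

theorem comm_S [NeZero p] (φ : MulAut (Fr p m))
    (h : Commute (S (Multiplicative.ofAdd (1 : ZMod p))) φ) (k : Zc p) : Commute (S k) φ := by
  have : k = (Multiplicative.ofAdd (1 : ZMod p)) ^ (Multiplicative.toAdd k).val := by
    rw [← ofAdd_nsmul]; simp
  rw [this, _root_.map_pow]
  exact h.pow_left _

theorem comm_inB [Fact (1 < p)] (φ : MulAut (Fr p m))
    (h : Commute (S (Multiplicative.ofAdd (1 : ZMod p))) φ) (b : FreeGroup (Fin m)) :
    φ (inB b) = inB (rB (φ (inB b))) := by
  obtain ⟨b', hb'⟩ := fixed_inB (φ (inB b)) (by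
    have := DFunLike.congr_fun h.eq (inB b)
    simpa only [MulAut.mul_apply, S_inB] using this)
  rw [hb', rB_inB]

theorem mem_comm [Fact (1 < p)] (φ : MulAut (Fr p m))
    (h : Commute (S (Multiplicative.ofAdd (1 : ZMod p))) φ) :
    Out.mk (Fr p m) φ ∈ (Th : _ →* Out (Fr p m)).range := by
  have : NeZero p := ⟨by have := Fact.out (p := 1 < p); omega⟩
  have h' : Commute (S (Multiplicative.ofAdd (1 : ZMod p))) φ⁻¹ := h.inv_right
  let α : MulAut (FreeGroup (Fin m)) := MonoidHom.toMulEquiv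
    (rB.comp (φ.toMonoidHom.comp inB)) (rB.comp (φ⁻¹.toMonoidHom.comp inB))
    (by
      refine MonoidHom.ext fun b => ?_
      change rB (φ⁻¹ (inB (rB (φ (inB b))))) = b
      rw [← comm_inB φ h, MulAut.inv_apply_self, rB_inB])
    (by
      refine MonoidHom.ext fun b => ?_
      change rB (φ (inB (rB (φ⁻¹ (inB b))))) = b
      rw [← comm_inB φ⁻¹ h', MulAut.apply_inv_self, rB_inB])
  have hα : ∀ b, φ (inB b) = inB (α b) := comm_inB φ h
  have hψ := mem_psi (φ * A (SemidirectProduct.inr α⁻¹))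
    (fun k => (comm_S φ h k).mul_right (S_A _ _)) (by
      intro b
      rw [MulAut.mul_apply, A_inB, hα, SemidirectProduct.right_inr, MulAut.apply_inv_self])
  have : Out.mk (Fr p m) φ = Out.mk (Fr p m) (φ * A (SemidirectProduct.inr α⁻¹)) *
      Out.mk (Fr p m) (A (SemidirectProduct.inr α)) := by
    rw [← _root_.map_mul, mul_assoc, ← _root_.map_mul, ← _root_.map_mul]; simp
  rw [this]
  exact mul_mem hψ (mem_A _)

theorem range_Th [Fact (1 < p)] : (Th : _ →* Out (Fr p m)).range =
    Subgroup.centralizer {Out.mk (Fr p m) (S (Multiplicative.ofAdd (1 : ZMod p)))} := by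
  have hp0 : p ≠ 0 := by have := Fact.out (p := 1 < p); omega
  apply le_antisymm
  · rintro _ ⟨x, rfl⟩
    rw [Subgroup.mem_centralizer_singleton_iff, Th_apply]
    refine Commute.eq (Commute.map (Commute.symm (Commute.mul_right ?_
      ((S_A _ _).mul_right (S_z2 _ _)))) _)
    rw [Commute, SemiconjBy, ← _root_.map_mul, ← _root_.map_mul, mul_comm]
  · intro y hy
    obtain ⟨φ, rfl⟩ : ∃ φ, Out.mk (Fr p m) φ = y := QuotientGroup.mk'_surjective _ y
    rw [Subgroup.mem_centralizer_singleton_iff] at hy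
    set s : MulAut (Fr p m) := S (Multiplicative.ofAdd (1 : ZMod p)) with hs
    have hsp : s ^ p = 1 := by
      rw [hs, ← _root_.map_pow, ← ofAdd_nsmul]; simp
    rw [← _root_.map_mul, ← _root_.map_mul, out_eq] at hy
    obtain ⟨g, hg⟩ := hy
    have h1 : MulAut.conj g * s = φ * s * φ⁻¹ := by rw [hg]; group
    have h2 : (MulAut.conj g * s) ^ p = 1 := by
      rw [h1, conj_pow, hsp]; simp
    rw [conj_mul_pow, hsp, mul_one] at h2
    have h3 : tnorm s g p = 1 := conj_inj (by rw [h2, _root_.map_one])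
    have hπ : ∀ k : ℕ, (permS p m 1) ^ k = permS p m k := by
      intro k
      induction k with
      | zero => ext x; rcases x with x | x <;> simp [permS]
      | succ k ih =>
        rw [pow_succ, ih]
        ext x
        rcases x with x | x <;> simp [permS, add_assoc]
    have hπp : (permS p m 1) ^ p = 1 := by
      rw [hπ]; ext x; rcases x with x | x <;> simp [permS]
    obtain ⟨h, hh⟩ := twisted_h1 (permS p m 1) p hp0 hπp _ g le_rfl h3
    have hh' : g = h * s h⁻¹ := hh
    have hcomm : Commute s (MulAut.conj h⁻¹ * φ) := by
      have e1 : MulAut.conj g * s = MulAut.conj h * s * MulAut.conj h⁻¹ := by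
        rw [hh']
        refine MulEquiv.ext fun x => ?_
        simp [mul_assoc]
      rw [e1] at h1
      have e2 : φ * s = MulAut.conj h * s * MulAut.conj h⁻¹ * φ := by rw [h1]; simp
      rw [Commute, SemiconjBy, mul_assoc (MulAut.conj h⁻¹), e2]
      simp [mul_assoc]
    have := mem_comm _ hcomm
    rwa [_root_.map_mul, mem_conj, one_mul] at this

end Surj

/-! ### Transport to the standard basis -/

theorem congr_conj {G H : Type} [Group G] [Group H] (e : G ≃* H) (g : G) :
    MulAut.congr e (MulAut.conj g) = MulAut.conj (e g) := by
  refine MulEquiv.ext fun x => ?_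
  simp [MulAut.congr]

/-- An isomorphism of groups induces one of outer automorphism groups. -/
def outCongr {G H : Type} [Group G] [Group H] (e : G ≃* H) : Out G ≃* Out H :=
  QuotientGroup.congr _ _ (MulAut.congr e) (by
    ext x
    simp only [Subgroup.mem_map, MonoidHom.mem_range]
    constructor
    · rintro ⟨_, ⟨g, rfl⟩, rfl⟩
      exact ⟨e g, (congr_conj e g).symm⟩
    · rintro ⟨g, rfl⟩
      exact ⟨_, ⟨e.symm g, rfl⟩, by
        change MulAut.congr e _ = _
        rw [congr_conj]; simp⟩)

theorem outCongr_mk {G H : Type} [Group G] [Group H] (e : G ≃* H) (φ : MulAut G) :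
    outCongr e (Out.mk G φ) = Out.mk H (MulAut.congr e φ) := rfl

/-- The identification of the bases. -/
def eR (q : ℕ) (h2 : 2 ≤ q + 1) : ZMod (q + 1) ⊕ Fin (q + 1 - 2) ≃ Fin (2 * (q + 1 - 1)) :=
  eRose (q + 1) h2

/-- The isomorphism of free groups. -/
def eF (q : ℕ) (h2 : 2 ≤ q + 1) :
    Fr (q + 1) (q + 1 - 2) ≃* FreeGroup (Fin (2 * (q + 1 - 1))) := freeGroupCongr (eR q h2)

theorem eF_X (q : ℕ) (h2 : 2 ≤ q + 1) (i : ZMod (q + 1)) :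
    eF q h2 (X i) = of (eR q h2 (Sum.inl i)) := by
  simp [eF, X]

theorem eF_inB (q : ℕ) (h2 : 2 ≤ q + 1) (j : Fin (q + 1 - 2)) :
    eF q h2 (inB (of j)) = of (eR q h2 (Sum.inr j)) := by
  simp [eF]

theorem ERose_gen (q : ℕ) (h2 : 2 ≤ q + 1) :
    formalGen (eRose (q + 1) h2) (rhsRose (q + 1)) =
      {outCongr (eF q h2)
        (Out.mk (Fr (q + 1) (q + 1 - 2)) (S (Multiplicative.ofAdd (1 : ZMod (q + 1)))))} := by
  obtain ⟨σ, hσ⟩ : ∃ σ, σ = MulAut.congr (eF q h2)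
    (S (Multiplicative.ofAdd (1 : ZMod (q + 1)))) := ⟨_, rfl⟩
  have hσ' : ∀ g, σ (eF q h2 g) = eF q h2 (S (Multiplicative.ofAdd (1 : ZMod (q + 1))) g) := by
    intro g
    rw [hσ]
    simp [MulAut.congr]
  have hσX : ∀ i : ZMod (q + 1),
      σ (of (eR q h2 (Sum.inl i))) = of (eR q h2 (Sum.inl (i + 1))) := by
    intro i
    have h := hσ' (X i)
    rw [S_X, eF_X, eF_X, toAdd_ofAdd, add_comm 1 i] at h
    exact h
  have key : ∀ k : Fin (q + 1) ⊕ Fin (q + 1 - 2),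
      σ (of (eRose (q + 1) h2 k)) =
      freeGroupCongr (eRose (q + 1) h2) (rhsRose (q + 1) k) := by
    rintro (i | j)
    · refine (hσX i).trans ?_
      simp only [rhsRose, finRotate_apply, freeGroupCongr_apply, FreeGroup.map.of]
      rfl
    · have h := hσ' (inB (of j))
      rw [S_inB, eF_inB] at h
      refine h.trans ?_
      simp only [rhsRose, freeGroupCongr_apply, FreeGroup.map.of]
      rfl
  rw [outCongr_mk, ← hσ]
  ext x
  constructor
  · rintro ⟨φ, h, rfl⟩
    have : φ.toMonoidHom = σ.toMonoidHom := by
      ext i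
      obtain ⟨k, rfl⟩ := (eRose (q + 1) h2).surjective i
      exact (h k).trans (key k).symm
    have h3 : φ = σ := MulEquiv.ext fun x => DFunLike.congr_fun this x
    rw [h3]; exact Set.mem_singleton _
  · intro hx
    exact ⟨σ, key, hx⟩

theorem ERose_cent (p : ℕ) (h2 : 2 ≤ p) : Nonempty
      ((Subgroup.centralizer ((ERose p h2 : Subgroup (OutF (2 * (p - 1)))) :
          Set (OutF (2 * (p - 1))))) ≃* Zc p × FAutZ2 (p - 2)) := by
  obtain ⟨q, rfl⟩ : ∃ q, p = q + 1 := ⟨p - 1, by omega⟩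
  have : Fact (1 < q + 1) := ⟨h2⟩
  rw [ERose, Subgroup.centralizer_closure, ERose_gen]
  generalize outCongr (eF q h2) = E
  have hF : Function.Injective (E.toMonoidHom.comp Th) := E.injective.comp Th_inj
  have hr : (E.toMonoidHom.comp Th).range =
      Subgroup.centralizer {E (Out.mk (Fr (q + 1) (q + 1 - 2))
      (S (Multiplicative.ofAdd (1 : ZMod (q + 1)))))} := by
    rw [MonoidHom.range_comp, range_Th]
    ext x
    obtain ⟨y, rfl⟩ := E.surjective x
    rw [Subgroup.mem_centralizer_singleton_iff, ← _root_.map_mul, ← _root_.map_mul,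
      E.injective.eq_iff, ← Subgroup.mem_centralizer_singleton_iff]
    exact Subgroup.mem_map_iff_mem E.injective
  exact ⟨((MonoidHom.ofInjective hF).trans (MulEquiv.subgroupCongr hr)).symm⟩


/-!
STATEMENT 4.  Let `p > 3` be a prime and `n = 2(p-1)`.  The centralizer of `E_R` in
`Out(F_n)` is isomorphic to `Z/p × ((F_{p-2} ⋊ Aut(F_{p-2})) ⋊ Z/2)`, where
`Aut(F_{p-2})` acts canonically on `F_{p-2}` and the generator `τ` of `Z/2` acts on
`F_{p-2} ⋊ Aut(F_{p-2})` by `τ(x, α)τ⁻¹ = (x⁻¹, c_x α)` (`c_x` = conjugation by `x`).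
-/
theorem statement4 (p : ℕ) (hp : p.Prime) (hp3 : 3 < p) :
    Nonempty
      ((Subgroup.centralizer ((ERose p (by omega) : Subgroup (OutF (2 * (p - 1)))) :
          Set (OutF (2 * (p - 1))))) ≃*
        Zc p × FAutZ2 (p - 2)) := by
  exact ERose_cent p _

end OutFormal
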